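/- arXiv:1909.02118 — 6 statements merged into one kernel-verified Lean document; each statement's English description precedes it below -/
import Mathlib

section
/- Let γ(t) = (t, t²) and let b : ℝ² → ℂ be locally integrable with ‖b‖_{BMO_γ} < ∞. Then b satisfies the testing-BMO condition, and there is an absolute constant C such that ‖b‖_{test} ≤ C ‖b‖_{BMO_γ}. -/
open MeasureTheory Set Filter

noncomputable section

/-- The parabolic curve `γ(t) = (t, t²)` in `ℝ²`. -/
def pgamma (t : ℝ) : ℝ × ℝ := (t, t ^ 2)

/-- A parabolic cube `Q = I ×ˢ J` where `I, J` are intervals with `|J| = |I|²`;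
`l = |I|` is the side length `ℓ(Q)`. -/
def IsPCube (Q : Set (ℝ × ℝ)) (l : ℝ) : Prop :=
  0 < l ∧ ∃ a c : ℝ, Q = Ico a (a + l) ×ˢ Ico c (c + l ^ 2)

/-- The average `b_Q = |Q|⁻¹ ∫_Q b`. -/
def avgC (Q : Set (ℝ × ℝ)) (b : ℝ × ℝ → ℂ) : ℂ :=
  (volume Q).toReal⁻¹ • ∫ x in Q, b x

/-- The mean oscillation `|Q|⁻¹ ∫_Q |b - b_Q|`. -/
def oscC (Q : Set (ℝ × ℝ)) (b : ℝ × ℝ → ℂ) : ℝ :=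
  (volume Q).toReal⁻¹ * ∫ x in Q, ‖b x - avgC Q b‖

/-- `HasPV F L` : the principal value `lim_{ε → 0⁺} ∫_{ε ≤ |t| ≤ 1/ε} F(t) dt = L`. -/
def HasPV (F : ℝ → ℂ) (L : ℂ) : Prop :=
  Tendsto (fun ε : ℝ => ∫ t in {t : ℝ | ε ≤ |t| ∧ |t| ≤ ε⁻¹}, F t)
    (nhdsWithin 0 (Set.Ioi 0)) (nhds L)

/-- The integrand of the commutator `[b, H_γ] f (x) = p.v. ∫ (b(x) - b(x-γ(t))) f(x-γ(t)) dt/t`. -/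
def commKer (b f : ℝ × ℝ → ℂ) (x : ℝ × ℝ) (t : ℝ) : ℂ :=
  (b x - b (x - pgamma t)) * f (x - pgamma t) / (t : ℂ)

/-- `E_Q = {x - γ(t) : x ∈ Q, 9ℓ(Q) ≤ t ≤ 10ℓ(Q)}`, the parabolic flow of the cube `Q`. -/
def tube (Q : Set (ℝ × ℝ)) (l : ℝ) : Set (ℝ × ℝ) :=
  {p | ∃ x ∈ Q, ∃ t ∈ Icc (9 * l) (10 * l), p = x - pgamma t}

/-- `I_{x,E} = {t ∈ ℝ : x - γ(t) ∈ E}`. -/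
def timeSet (x : ℝ × ℝ) (E : Set (ℝ × ℝ)) : Set ℝ := {t : ℝ | x - pgamma t ∈ E}

/-- `μ(S) = ∫_S dt/t`, the Haar measure `dt/t` on `(0,∞)` of `S`. -/
def haarM (S : Set ℝ) : ℝ := ∫ t in S ∩ Ioi 0, t⁻¹

/-- `μ(I_{x,E})⁻¹ ∫_{I_{x,E}} b(x - γ(t)) dμ(t)`, the average of `b` along the parabolic
trajectory based at `x` over the times spent in `E`, with respect to `dμ(t) = dt/t`. -/
def curveAvg (b : ℝ × ℝ → ℂ) (x : ℝ × ℝ) (E : Set (ℝ × ℝ)) : ℂ :=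
  (haarM (timeSet x E))⁻¹ • ∫ t in timeSet x E ∩ Ioi 0, b (x - pgamma t) / (t : ℂ)

/-- The testing oscillation `|Q|⁻¹ ∫_Q |b(x) - μ(I_{x,E_Q})⁻¹ ∫_{I_{x,E_Q}} b(x-γ(t)) dμ(t)| dx`. -/
def testOsc (Q : Set (ℝ × ℝ)) (l : ℝ) (b : ℝ × ℝ → ℂ) : ℝ :=
  (volume Q).toReal⁻¹ * ∫ x in Q, ‖b x - curveAvg b x (tube Q l)‖

/-- For `x` in a parabolic cube, the times at which the trajectory from `x` meets the tube contain
`[9l, 10l]`. -/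
lemma Icc_subset_timeSet_tube {Q : Set (ℝ × ℝ)} {l : ℝ} {x : ℝ × ℝ} (hx : x ∈ Q) :
    Icc (9 * l) (10 * l) ⊆ timeSet x (tube Q l) :=
  fun t ht => ⟨x, hx, t, ht, rfl⟩

/-- For `x` in a parabolic cube, the trajectory from `x` meets the tube only at times in
`[8l, 11l]`. -/
lemma timeSet_tube_subset_Icc {a l : ℝ} {J : Set ℝ} {x : ℝ × ℝ} (hx : x ∈ Ico a (a + l) ×ˢ J) :
    timeSet x (tube (Ico a (a + l) ×ˢ J) l) ⊆ Icc (8 * l) (11 * l) := by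
  rintro t ⟨y, hy, s, hs, h⟩
  have h1 : x.1 - t = y.1 - s := congrArg Prod.fst h
  have hx1 := hx.1
  have hy1 := hy.1
  simp only [mem_Ico] at hx1 hy1
  simp only [mem_Icc] at hs ⊢
  constructor <;> linarith

/-- A parabolic cube moved by `-γ(t)`, `8l ≤ t ≤ 11l`, stays in a fixed cube of side `12l`. -/
lemma sub_pgamma_mem {a c l t : ℝ} {x : ℝ × ℝ} (hl : 0 < l)
    (hx : x ∈ Ico a (a + l) ×ˢ Ico c (c + l ^ 2)) (ht : t ∈ Icc (8 * l) (11 * l)) :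
    x - pgamma t ∈ Ico (a - 11 * l) (a - 11 * l + 12 * l) ×ˢ
      Ico (c - 143 * l ^ 2) (c - 143 * l ^ 2 + (12 * l) ^ 2) := by
  obtain ⟨⟨h1, h2⟩, h3, h4⟩ := hx
  obtain ⟨h5, h6⟩ := ht
  simp only [pgamma, mem_prod, mem_Ico, Prod.fst_sub, Prod.snd_sub]
  refine ⟨⟨by linarith, by linarith⟩, ?_, ?_⟩ <;> nlinarith

lemma volume_toReal_pcube {a c l : ℝ} (hl : 0 < l) :
    (volume (Ico a (a + l) ×ˢ Ico c (c + l ^ 2))).toReal = l ^ 3 := by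
  rw [Measure.volume_eq_prod, Measure.prod_prod, Real.volume_Ico, Real.volume_Ico,
    ENNReal.toReal_mul, ENNReal.toReal_ofReal (by linarith),
    ENNReal.toReal_ofReal (by nlinarith)]
  ring

/-- An average with respect to `dt/t` over a set of times between `[9l, 10l]` and `[8l, 11l]`
differs from a constant by at most a multiple of the mean deviation on `[8l, 11l]`. -/
lemma norm_haarAverage_sub_le {l : ℝ} (hl : 0 < l) {S : Set ℝ}
    (hS : Icc (9 * l) (10 * l) ⊆ S) (hS' : S ⊆ Icc (8 * l) (11 * l)) {u : ℝ → ℂ} {k : ℂ}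
    (hu : IntegrableOn (fun t => u t - k) (Icc (8 * l) (11 * l))) :
    ‖(∫ t in S, t⁻¹)⁻¹ • (∫ t in S, u t / (t : ℂ)) - k‖ ≤
      10 / (8 * l) * ∫ t in Icc (8 * l) (11 * l), ‖u t - k‖ := by
  have hpos : ∀ t ∈ Icc (8 * l) (11 * l), 0 < t := fun t ht => by linarith [ht.1]
  have hcont : ContinuousOn (fun t : ℝ => t⁻¹) (Icc (8 * l) (11 * l)) :=
    continuousOn_inv₀.mono fun t ht => (hpos t ht).ne'
  have hinv : IntegrableOn (fun t : ℝ => t⁻¹) (Icc (8 * l) (11 * l)) :=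
    hcont.integrableOn_compact isCompact_Icc
  have hmem : ∀ᵐ t ∂volume.restrict S, t ∈ Icc (8 * l) (11 * l) :=
    ae_restrict_of_ae_restrict_of_subset hS' (ae_restrict_mem measurableSet_Icc)
  have hmass : 1 / 10 ≤ ∫ t in S, t⁻¹ := by
    have h1 : ∫ t in Icc (9 * l) (10 * l), (10 * l)⁻¹ ≤ ∫ t in Icc (9 * l) (10 * l), t⁻¹ := by
      refine setIntegral_mono_on (integrable_const _) (hinv.mono_set (hS.trans hS'))
        measurableSet_Icc ?_
      intro t ht
      exact inv_anti₀ (hpos t (hS' (hS ht))) ht.2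
    have h2 : ∫ t in Icc (9 * l) (10 * l), t⁻¹ ≤ ∫ t in S, t⁻¹ := by
      refine setIntegral_mono_set (hinv.mono_set hS') ?_ hS.eventuallyLE
      filter_upwards [hmem] with t ht using (inv_pos.2 (hpos t ht)).le
    have h3 : ∫ t in Icc (9 * l) (10 * l), (10 * l)⁻¹ = 1 / 10 := by
      rw [setIntegral_const, Real.volume_real_Icc_of_le (by linarith), smul_eq_mul]
      field_simp
      ring
    linarith
  set m := ∫ t in S, t⁻¹ with hm
  have hm0 : 0 < m := by linarith
  have hdiv : IntegrableOn (fun t : ℝ => t⁻¹ • (u t - k)) (Icc (8 * l) (11 * l)) :=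
    hu.continuousOn_smul hcont isCompact_Icc
  have hsplit : ∫ t in S, u t / (t : ℂ) = (∫ t in S, t⁻¹ • (u t - k)) + m • k := by
    rw [hm, ← integral_smul_const, ← integral_add (hdiv.mono_set hS')
      ((hinv.mono_set hS').smul_const k)]
    refine integral_congr_ae (.of_forall fun t => ?_)
    simp only [Complex.real_smul, Complex.ofReal_inv]
    ring
  rw [hsplit, smul_add, smul_smul, inv_mul_cancel₀ hm0.ne', one_smul, add_sub_cancel_right,
    norm_smul, Real.norm_of_nonneg (inv_pos.2 hm0).le]
  have hbound : ‖∫ t in S, t⁻¹ • (u t - k)‖ ≤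
      (8 * l)⁻¹ * ∫ t in Icc (8 * l) (11 * l), ‖u t - k‖ := by
    calc ‖∫ t in S, t⁻¹ • (u t - k)‖
        ≤ ∫ t in S, ‖t⁻¹ • (u t - k)‖ := norm_integral_le_integral_norm _
      _ ≤ ∫ t in Icc (8 * l) (11 * l), ‖t⁻¹ • (u t - k)‖ :=
          setIntegral_mono_set hdiv.norm (.of_forall fun t => norm_nonneg _) hS'.eventuallyLE
      _ ≤ ∫ t in Icc (8 * l) (11 * l), (8 * l)⁻¹ * ‖u t - k‖ := by
          refine setIntegral_mono_on hdiv.norm (hu.norm.const_mul _) measurableSet_Icc ?_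
          intro t ht
          rw [norm_smul, norm_inv, Real.norm_of_nonneg (hpos t ht).le]
          exact mul_le_mul_of_nonneg_right (inv_anti₀ (by positivity) ht.1) (norm_nonneg _)
      _ = _ := integral_const_mul _ _
  have hm' : m⁻¹ ≤ 10 := by
    rw [inv_le_comm₀ hm0 (by norm_num)]
    linarith
  calc m⁻¹ * ‖∫ t in S, t⁻¹ • (u t - k)‖
      ≤ 10 * ((8 * l)⁻¹ * ∫ t in Icc (8 * l) (11 * l), ‖u t - k‖) := by gcongr
    _ = _ := by ring

/-- Translating an integrable function along the parabola over a finite measure of times gives a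
jointly integrable function. -/
lemma integrable_comp_sub_pgamma {h : ℝ × ℝ → ℂ} (hh : Integrable h) (ν : Measure ℝ)
    [IsFiniteMeasure ν] :
    Integrable (fun p : ℝ × (ℝ × ℝ) => h (p.2 - pgamma p.1)) (ν.prod volume) := by
  have hγ : Measurable pgamma := by unfold pgamma; fun_prop
  have hmp : MeasurePreserving (fun p : ℝ × (ℝ × ℝ) => (p.1, p.2 - pgamma p.1))
      (ν.prod volume) (ν.prod volume) := by
    refine (MeasurePreserving.id ν).skew_product (g := fun t x => x - pgamma t) ?_ ?_
    · exact measurable_snd.sub (hγ.comp measurable_fst)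
    · exact .of_forall fun t => (measurePreserving_sub_right volume (pgamma t)).map_eq
  exact hmp.integrable_comp_of_integrable (hh.comp_snd ν)

lemma integral_integral_norm_comp_sub_pgamma {h : ℝ × ℝ → ℂ} (hh : Integrable h) (ν : Measure ℝ)
    [IsFiniteMeasure ν] :
    ∫ x, ∫ t, ‖h (x - pgamma t)‖ ∂ν = ν.real univ * ∫ x, ‖h x‖ := by
  rw [← integral_integral_swap (f := fun t x => ‖h (x - pgamma t)‖)
    (integrable_comp_sub_pgamma hh ν).norm]
  simp_rw [integral_sub_right_eq_self (fun x => ‖h x‖)]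
  rw [integral_const, smul_eq_mul]

/-- If `b ∈ BMO_γ` then `b` satisfies the commutator testing condition, with
`‖b‖_test ≤ C ‖b‖_{BMO_γ}` for an absolute constant `C`. -/
theorem parabolic_bmo_implies_testing :
    ∃ C : ℝ, 0 < C ∧
      ∀ b : ℝ × ℝ → ℂ, LocallyIntegrable b volume →
      ∀ B : ℝ, (∀ Q l, IsPCube Q l → oscC Q b ≤ B) →
      ∀ Q l, IsPCube Q l → testOsc Q l b ≤ C * B := by
  refine ⟨8208, by norm_num, ?_⟩
  rintro b hb B hB Q l ⟨hl, a, c, rfl⟩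
  set Q := Ico a (a + l) ×ˢ Ico c (c + l ^ 2)
  set R := Ico (a - 11 * l) (a - 11 * l + 12 * l) ×ˢ
      Ico (c - 143 * l ^ 2) (c - 143 * l ^ 2 + (12 * l) ^ 2)
  have hQm : MeasurableSet Q := measurableSet_Ico.prod measurableSet_Ico
  have hRm : MeasurableSet R := measurableSet_Ico.prod measurableSet_Ico
  have hQR : Q ⊆ R := by
    refine prod_mono (Ico_subset_Ico ?_ ?_) (Ico_subset_Ico ?_ ?_) <;> nlinarith
  have hosc := hB R (12 * l) ⟨by positivity, _, _, rfl⟩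
  rw [oscC, volume_toReal_pcube (by positivity), inv_mul_le_iff₀ (by positivity)] at hosc
  set k := avgC R b
  have hRK : R ⊆ Icc (a - 11 * l) (a - 11 * l + 12 * l) ×ˢ
      Icc (c - 143 * l ^ 2) (c - 143 * l ^ 2 + (12 * l) ^ 2) :=
    prod_mono Ico_subset_Icc_self Ico_subset_Icc_self
  have hbR : IntegrableOn (fun x => b x - k) R :=
    ((hb.sub (locallyIntegrable_const k)).integrableOn_isCompact
      (isCompact_Icc.prod isCompact_Icc)).mono_set hRK
  set h : ℝ × ℝ → ℂ := R.indicator fun x => b x - k with hh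
  have hint : Integrable h := hbR.integrable_indicator hRm
  set ν : Measure ℝ := volume.restrict (Icc (8 * l) (11 * l)) with hν
  have hprod := integrable_comp_sub_pgamma hint ν
  have hnorm : ∫ x, ‖h x‖ = ∫ x in R, ‖b x - k‖ := by
    rw [← integral_indicator hRm]
    simp only [hh, norm_indicator_eq_indicator_norm]
  have hmaj : Integrable fun x => ‖h x‖ + 10 / (8 * l) * ∫ t, ‖h (x - pgamma t)‖ ∂ν :=
    hint.norm.add (hprod.integral_norm_prod_right.const_mul _)
  have hpt : ∀ᵐ x ∂volume.restrict Q, ‖b x - curveAvg b x (tube Q l)‖ ≤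
      ‖h x‖ + 10 / (8 * l) * ∫ t, ‖h (x - pgamma t)‖ ∂ν := by
    filter_upwards [ae_restrict_mem hQm, ae_restrict_of_ae hprod.prod_left_ae] with x hx hxi
    have heq : EqOn (fun t => h (x - pgamma t)) (fun t => b (x - pgamma t) - k)
        (Icc (8 * l) (11 * l)) := fun t ht => indicator_of_mem (sub_pgamma_mem hl hx ht) _
    have hS : timeSet x (tube Q l) ∩ Ioi 0 ⊆ Icc (8 * l) (11 * l) :=
      inter_subset_left.trans (timeSet_tube_subset_Icc hx)
    have hS' : Icc (9 * l) (10 * l) ⊆ timeSet x (tube Q l) ∩ Ioi 0 := fun t ht =>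
      ⟨Icc_subset_timeSet_tube hx ht, lt_of_lt_of_le (by positivity) ht.1⟩
    have havg := norm_haarAverage_sub_le hl hS' hS
      (IntegrableOn.congr_fun hxi heq measurableSet_Icc)
    have hcongr : ∫ t, ‖h (x - pgamma t)‖ ∂ν =
        ∫ t in Icc (8 * l) (11 * l), ‖b (x - pgamma t) - k‖ :=
      setIntegral_congr_fun measurableSet_Icc fun t ht => congrArg norm (heq ht)
    have hhx : h x = b x - k := indicator_of_mem (hQR hx) _
    rw [hcongr, hhx]
    calc ‖b x - curveAvg b x (tube Q l)‖
        = ‖(b x - k) - (curveAvg b x (tube Q l) - k)‖ := by congr 1; ring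
      _ ≤ ‖b x - k‖ + ‖curveAvg b x (tube Q l) - k‖ := norm_sub_le _ _
      _ ≤ _ := by gcongr; exact havg
  have hν' : ν.real univ = 3 * l := by
    rw [hν, measureReal_restrict_apply_univ, Real.volume_real_Icc_of_le (by linarith)]
    ring
  have hmain : ∫ x in Q, ‖b x - curveAvg b x (tube Q l)‖ ≤
      (1 + 30 / 8) * ∫ x in R, ‖b x - k‖ := by
    calc ∫ x in Q, ‖b x - curveAvg b x (tube Q l)‖
        ≤ ∫ x in Q, (‖h x‖ + 10 / (8 * l) * ∫ t, ‖h (x - pgamma t)‖ ∂ν) :=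
          integral_mono_of_nonneg (.of_forall fun x => norm_nonneg _) hmaj.integrableOn hpt
      _ ≤ ∫ x, (‖h x‖ + 10 / (8 * l) * ∫ t, ‖h (x - pgamma t)‖ ∂ν) :=
          setIntegral_le_integral hmaj (.of_forall fun x => by positivity)
      _ = (1 + 30 / 8) * ∫ x in R, ‖b x - k‖ := by
          rw [integral_add hint.norm (hprod.integral_norm_prod_right.const_mul _),
            integral_const_mul, integral_integral_norm_comp_sub_pgamma hint, hν', hnorm]
          field_simp
          ring
  rw [testOsc, volume_toReal_pcube hl, inv_mul_le_iff₀ (by positivity)]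
  nlinarith
end
end

section
/- Let b = Σ_Q b_Q χ_Q be a locally integrable function on ℝ² that is constant on each member of a pairwise disjoint collection of parabolic cubes {Q} (with constant value b_Q on Q). If Q and R are two adjacent parabolic cubes of the collection (sharing a common boundary face, with R lying directly below or directly to the left of Q), then |b_Q − b_R| ≤ ‖b‖_{test}. -/
open MeasureTheory Set Filter

noncomputable section

/-- The time set of a tube is measurable: if some flow time in `[9s, 10s]` brings `x - γ(t)` back
into the cube, then so does the least one `m t` meeting the lower constraints, and `m` is
continuous. -/
lemma measurableSet_timeSet_tube (x : ℝ × ℝ) (a c : ℝ) {s : ℝ} (hs : 0 < s) :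
    MeasurableSet (timeSet x (tube (Ico a (a + s) ×ˢ Ico c (c + s ^ 2)) s)) := by
  set m : ℝ → ℝ := fun t =>
    max (max (9 * s) (a - x.1 + t)) (Real.sqrt (c - x.2 + t ^ 2))
  have hmc : Continuous m := by fun_prop
  have key : timeSet x (tube (Ico a (a + s) ×ˢ Ico c (c + s ^ 2)) s) =
      {t | m t ≤ 10 * s} ∩ ({t | m t < a + s - x.1 + t} ∩
        {t | m t ^ 2 < c + s ^ 2 - x.2 + t ^ 2}) := by
    ext t
    have h1 : 9 * s ≤ m t := le_trans (le_max_left _ _) (le_max_left _ _)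
    have h2 : a - x.1 + t ≤ m t := le_trans (le_max_right _ _) (le_max_left _ _)
    have h3 : c - x.2 + t ^ 2 ≤ m t ^ 2 :=
      (Real.sqrt_le_left (by linarith)).1 (le_max_right _ _)
    constructor
    · rintro ⟨y, ⟨⟨hy1, hy2⟩, hy3, hy4⟩, u, ⟨hu1, hu2⟩, hxy⟩
      have e1 : x.1 - t = y.1 - u := congrArg Prod.fst hxy
      have e2 : x.2 - t ^ 2 = y.2 - u ^ 2 := congrArg Prod.snd hxy
      have hmu : m t ≤ u := by
        refine max_le (max_le hu1 (by linarith)) ?_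
        exact (Real.sqrt_le_left (by linarith)).2 (by linarith)
      have hmu2 : m t ^ 2 ≤ u ^ 2 := pow_le_pow_left₀ (by linarith) hmu 2
      refine ⟨?_, ?_, ?_⟩ <;> simp only [mem_ofPred_eq] <;> linarith
    · rintro ⟨k1, k2, k3⟩
      simp only [mem_ofPred_eq] at k1 k2 k3
      refine ⟨(x.1 - t + m t, x.2 - t ^ 2 + m t ^ 2),
        ⟨⟨?_, ?_⟩, ?_, ?_⟩, m t, ⟨h1, k1⟩, ?_⟩
      · simp only; linarith
      · simp only; linarith
      · simp only; linarith
      · simp only; linarith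
      · ext <;> simp [pgamma]
  rw [key]
  refine (measurableSet_le hmc.measurable measurable_const).inter
    ((measurableSet_lt hmc.measurable (by fun_prop)).inter
      (measurableSet_lt (by fun_prop) (by fun_prop)))

lemma haarM_timeSet_tube_pos {x : ℝ × ℝ} {a c s : ℝ} (hs : 0 < s)
    (hx : x ∈ Ico a (a + s) ×ˢ Ico c (c + s ^ 2)) :
    0 < haarM (timeSet x (tube (Ico a (a + s) ×ˢ Ico c (c + s ^ 2)) s)) := by
  set S := timeSet x (tube (Ico a (a + s) ×ˢ Ico c (c + s ^ 2)) s)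
  have hSm : MeasurableSet (S ∩ Ioi 0) :=
    (measurableSet_timeSet_tube x a c hs).inter measurableSet_Ioi
  have hlow : Icc (9 * s) (10 * s) ⊆ S ∩ Ioi 0 := fun t ht =>
    ⟨⟨x, hx, t, ht, rfl⟩, lt_of_lt_of_le (by linarith) ht.1⟩
  have hup : S ∩ Ioi 0 ⊆ Icc (8 * s) (11 * s) := by
    rintro t ⟨⟨y, ⟨⟨hy1, hy2⟩, -⟩, u, ⟨hu1, hu2⟩, hxy⟩, -⟩
    have e1 : x.1 - t = y.1 - u := congrArg Prod.fst hxy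
    obtain ⟨⟨hx1, hx2⟩, -⟩ := hx
    constructor <;> linarith
  have hint : IntegrableOn (fun t : ℝ => t⁻¹) (S ∩ Ioi 0) := by
    refine IntegrableOn.mono_set (ContinuousOn.integrableOn_Icc ?_) hup
    refine continuousOn_id.inv₀ fun t ht => ?_
    have : 0 < t := lt_of_lt_of_le (by linarith) ht.1
    exact this.ne'
  unfold haarM
  rw [setIntegral_pos_iff_support_of_nonneg_ae ?_ hint]
  · refine lt_of_lt_of_le ?_ (measure_mono (s := Icc (9 * s) (10 * s)) fun t ht =>
      ⟨?_, hlow ht⟩)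
    · rw [Real.volume_Icc]
      exact ENNReal.ofReal_pos.2 (by linarith)
    · have : 0 < t := (hlow ht).2
      exact inv_ne_zero this.ne'
  · filter_upwards [ae_restrict_mem hSm] with t ht
    exact inv_nonneg.2 (le_of_lt ht.2)

lemma curveAvg_tube_of_const {b : ℝ × ℝ → ℂ} {x : ℝ × ℝ} {a c s : ℝ} {q : ℂ} (hs : 0 < s)
    (hx : x ∈ Ico a (a + s) ×ˢ Ico c (c + s ^ 2))
    (hq : ∀ y ∈ tube (Ico a (a + s) ×ˢ Ico c (c + s ^ 2)) s, b y = q) :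
    curveAvg b x (tube (Ico a (a + s) ×ˢ Ico c (c + s ^ 2)) s) = q := by
  have hpos := haarM_timeSet_tube_pos hs hx
  have hSm := (measurableSet_timeSet_tube x a c hs).inter (measurableSet_Ioi (a := (0 : ℝ)))
  unfold curveAvg
  rw [setIntegral_congr_fun (g := fun t : ℝ => q * ((t⁻¹ : ℝ) : ℂ)) hSm fun t ht => by
    simp only [hq _ ht.1, Complex.ofReal_inv, div_eq_mul_inv]]
  rw [integral_const_mul, integral_complex_ofReal]
  change (haarM _)⁻¹ • (q * ((haarM _ : ℝ) : ℂ)) = q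
  have hne := Complex.ofReal_ne_zero.2 hpos.ne'
  rw [Complex.real_smul, Complex.ofReal_inv]
  field_simp

/-- The testing oscillation of a function equal to `p` on a cube and to `q` on its tube. -/
lemma testOsc_of_const {b : ℝ × ℝ → ℂ} {a c s : ℝ} {p q : ℂ} (hs : 0 < s)
    (hp : ∀ x ∈ Ico a (a + s) ×ˢ Ico c (c + s ^ 2), b x = p)
    (hq : ∀ y ∈ tube (Ico a (a + s) ×ˢ Ico c (c + s ^ 2)) s, b y = q) :
    testOsc (Ico a (a + s) ×ˢ Ico c (c + s ^ 2)) s b = ‖p - q‖ := by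
  have hvol : (volume (Ico a (a + s) ×ˢ Ico c (c + s ^ 2))).toReal = s * s ^ 2 := by
    rw [Measure.volume_eq_prod, Measure.prod_prod, Real.volume_Ico, Real.volume_Ico,
      ENNReal.toReal_mul, ENNReal.toReal_ofReal (by linarith),
      ENNReal.toReal_ofReal (by nlinarith)]
    ring
  unfold testOsc
  rw [setIntegral_congr_fun (g := fun _ => ‖p - q‖) (measurableSet_Ico.prod measurableSet_Ico)
    fun x hx => by simp only [hp x hx, curveAvg_tube_of_const hs hx hq]]
  rw [setIntegral_const, measureReal_def, hvol, smul_eq_mul]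
  field_simp

/-- Coordinate bounds for the tube of a cube of side `l / 20`. -/
lemma bounds_of_mem_tube {a c l : ℝ} (hl : 0 < l) {p : ℝ × ℝ}
    (hp : p ∈ tube (Ico a (a + l / 20) ×ˢ Ico c (c + (l / 20) ^ 2)) (l / 20)) :
    (a - l / 2 ≤ p.1 ∧ p.1 < a) ∧ c - l ^ 2 / 4 ≤ p.2 ∧ p.2 < c := by
  obtain ⟨y, ⟨⟨hy1, hy2⟩, hy3, hy4⟩, u, ⟨hu1, hu2⟩, rfl⟩ := hp
  have hu3 : (9 * (l / 20)) ^ 2 ≤ u ^ 2 := pow_le_pow_left₀ (by linarith) hu1 2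
  have hu4 : u ^ 2 ≤ (10 * (l / 20)) ^ 2 := pow_le_pow_left₀ (by linarith) hu2 2
  have hl2 : 0 < l ^ 2 := by positivity
  simp only [pgamma, Prod.fst_sub, Prod.snd_sub]
  refine ⟨⟨?_, ?_⟩, ?_, ?_⟩ <;> nlinarith

/-- If `b = Σ_Q b_Q χ_Q` is constant on each member of a pairwise disjoint collection of
parabolic cubes (and vanishes off their union), and `Q = Qs i`, `R = Qs j` are adjacent
parabolic cubes of the collection with `R` directly below or directly to the left of `Q`,
then `|b_Q - b_R| ≤ ‖b‖_test`. -/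
theorem simple_symbol_testing_bound
    {ι : Type*} (Qs : ι → Set (ℝ × ℝ)) (ls : ι → ℝ) (v : ι → ℂ) (b : ℝ × ℝ → ℂ)
    (hcube : ∀ i, IsPCube (Qs i) (ls i))
    (hdisj : ∀ i j, i ≠ j → Disjoint (Qs i) (Qs j))
    (hconst : ∀ i, ∀ x ∈ Qs i, b x = v i)
    (hzero : ∀ x, x ∉ ⋃ i, Qs i → b x = 0)
    (hb : LocallyIntegrable b volume)
    (i j : ι) (a c l : ℝ) (hl : 0 < l)
    (hQ : Qs i = Ico a (a + l) ×ˢ Ico c (c + l ^ 2))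
    (hR : Qs j = Ico a (a + l) ×ˢ Ico (c - l ^ 2) c ∨
          Qs j = Ico (a - l) a ×ˢ Ico c (c + l ^ 2))
    (T : ℝ) (hT : ∀ Q' l', IsPCube Q' l' → testOsc Q' l' b ≤ T) :
    ‖v i - v j‖ ≤ T := by
  have hs : 0 < l / 20 := by linarith
  have hl2 : 0 < l ^ 2 := by positivity
  rcases hR with hR | hR
  · rw [← testOsc_of_const (b := b) (a := a + l / 2) (c := c) hs (fun x hx => ?_)
      (fun y hy => ?_)]
    · exact hT _ _ ⟨hs, _, _, rfl⟩
    · obtain ⟨⟨hx1, hx2⟩, hx3, hx4⟩ := hx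
      refine hconst i x ?_
      rw [hQ]
      refine ⟨⟨?_, ?_⟩, ?_, ?_⟩ <;> nlinarith
    · obtain ⟨⟨hy1, hy2⟩, hy3, hy4⟩ := bounds_of_mem_tube hl hy
      refine hconst j y ?_
      rw [hR]
      refine ⟨⟨?_, ?_⟩, ?_, ?_⟩ <;> linarith
  · rw [← testOsc_of_const (b := b) (a := a) (c := c + l ^ 2 / 4) hs (fun x hx => ?_)
      (fun y hy => ?_)]
    · exact hT _ _ ⟨hs, _, _, rfl⟩
    · obtain ⟨⟨hx1, hx2⟩, hx3, hx4⟩ := hx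
      refine hconst i x ?_
      rw [hQ]
      refine ⟨⟨?_, ?_⟩, ?_, ?_⟩ <;> nlinarith
    · obtain ⟨⟨hy1, hy2⟩, hy3, hy4⟩ := bounds_of_mem_tube hl hy
      refine hconst j y ?_
      rw [hR]
      refine ⟨⟨?_, ?_⟩, ?_, ?_⟩ <;> linarith
end
end

section
/- Let Q = I × J be a parabolic cube with ℓ(Q) = |I|, and set E_Q = {x − γ(t) : x ∈ Q, 9ℓ(Q) ≤ t ≤ 10ℓ(Q)} where γ(t) = (t, t²). Then for every x ∈ Q the set I_{x,E_Q} = {t ∈ ℝ : x − γ(t) ∈ E_Q} satisfies [9ℓ(Q), 10ℓ(Q)] ⊆ I_{x,E_Q} ⊆ [8ℓ(Q), 11ℓ(Q)], and consequently ln(10/9) ≤ ∫_{I_{x,E_Q}} dt/t ≤ ln(11/8). -/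
open MeasureTheory Set Filter

noncomputable section

/-- The measure `dt/t` of a compact interval of positive reals. -/
lemma haarM_Icc {u v : ℝ} (hu : 0 < u) (huv : u ≤ v) :
    haarM (Icc u v) = Real.log (v / u) := by
  have hpos : Icc u v ∩ Ioi 0 = Icc u v :=
    inter_eq_left.2 fun t ht => hu.trans_le ht.1
  rw [haarM, hpos, integral_Icc_eq_integral_Ioc, ← intervalIntegral.integral_of_le huv,
    integral_inv_of_pos hu (hu.trans_le huv)]

/-- Monotonicity of `dt/t` below a compact interval of positive reals; no measurability of
the smaller sets is needed. -/
lemma haarM_mono {S T : Set ℝ} {u v : ℝ} (hu : 0 < u) (hST : S ⊆ T) (hT : T ⊆ Icc u v) :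
    haarM S ≤ haarM T := by
  have hint : IntegrableOn (fun t : ℝ => t⁻¹) (Icc u v) :=
    (continuousOn_inv₀.mono fun t ht => (hu.trans_le ht.1).ne').integrableOn_Icc
  have hsub : T ∩ Ioi 0 ⊆ Icc u v := inter_subset_left.trans hT
  have hnonneg : 0 ≤ᵐ[volume.restrict (Icc u v)] fun t : ℝ => t⁻¹ :=
    (ae_restrict_mem measurableSet_Icc).mono fun t ht => inv_nonneg.2 (hu.le.trans ht.1)
  exact setIntegral_mono_set (hint.mono_set hsub) (ae_restrict_of_ae_restrict_of_subset hsub hnonneg)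
    (inter_subset_inter_left _ hST).eventuallyLE

/-- For a parabolic cube `Q` and every `x ∈ Q`, one has
`[9ℓ(Q), 10ℓ(Q)] ⊆ I_{x,E_Q} ⊆ [8ℓ(Q), 11ℓ(Q)]`, and consequently
`ln(10/9) ≤ ∫_{I_{x,E_Q}} dt/t ≤ ln(11/8)`. -/
theorem timeSet_bounds (a c l : ℝ) (hl : 0 < l) :
    ∀ x ∈ (Ico a (a + l) ×ˢ Ico c (c + l ^ 2) : Set (ℝ × ℝ)),
      Icc (9 * l) (10 * l) ⊆
          timeSet x (tube (Ico a (a + l) ×ˢ Ico c (c + l ^ 2)) l) ∧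
      timeSet x (tube (Ico a (a + l) ×ˢ Ico c (c + l ^ 2)) l) ⊆
          Icc (8 * l) (11 * l) ∧
      Real.log (10 / 9) ≤
          haarM (timeSet x (tube (Ico a (a + l) ×ˢ Ico c (c + l ^ 2)) l)) ∧
      haarM (timeSet x (tube (Ico a (a + l) ×ˢ Ico c (c + l ^ 2)) l)) ≤
          Real.log (11 / 8) := by
  intro x hx
  have hlow : Icc (9 * l) (10 * l) ⊆
      timeSet x (tube (Ico a (a + l) ×ˢ Ico c (c + l ^ 2)) l) :=
    fun t ht => ⟨x, hx, t, ht, rfl⟩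
  have hupp : timeSet x (tube (Ico a (a + l) ×ˢ Ico c (c + l ^ 2)) l) ⊆
      Icc (8 * l) (11 * l) := by
    rintro t ⟨y, hy, s, hs, h⟩
    have hfst : x.1 - t = y.1 - s := congrArg Prod.fst h
    obtain ⟨⟨hxa, hxl⟩, -⟩ := hx
    obtain ⟨⟨hya, hyl⟩, -⟩ := hy
    obtain ⟨hs₁, hs₂⟩ := hs
    constructor <;> linarith
  have h8 : 0 < 8 * l := by positivity
  refine ⟨hlow, hupp, ?_, ?_⟩
  · calc Real.log (10 / 9) = haarM (Icc (9 * l) (10 * l)) := by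
          rw [haarM_Icc (by positivity) (by linarith), mul_div_mul_right _ _ hl.ne']
      _ ≤ _ := haarM_mono h8 hlow hupp
  · calc _ ≤ haarM (Icc (8 * l) (11 * l)) := haarM_mono h8 hupp Subset.rfl
      _ = Real.log (11 / 8) := by
          rw [haarM_Icc h8 (by linarith), mul_div_mul_right _ _ hl.ne']
end
end

section
/- Let Q = I × J be a parabolic cube with ℓ(Q) = |I|, and set E_Q = {x − γ(t) : x ∈ Q, 9ℓ(Q) ≤ t ≤ 10ℓ(Q)} where γ(t) = (t, t²). Then the two-dimensional Lebesgue measure of E_Q is comparable to that of Q with absolute constants; in particular, |Q| ≤ |E_Q| ≤ 40 |Q|. -/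
open MeasureTheory Set Filter

noncomputable section

/-- The tube contains the translate of `Q` by `-γ(9ℓ)`. -/
theorem prod_Ico_subset_tube (a c l : ℝ) (hl : 0 < l) :
    Ico (a - 9 * l) (a - 9 * l + l) ×ˢ
        Ico (c - (9 * l) ^ 2) (c - (9 * l) ^ 2 + l ^ 2) ⊆
      tube (Ico a (a + l) ×ˢ Ico c (c + l ^ 2)) l := by
  rintro ⟨x, y⟩ ⟨⟨hx₁, hx₂⟩, hy₁, hy₂⟩
  dsimp only at hx₁ hx₂ hy₁ hy₂
  refine ⟨(x + 9 * l, y + (9 * l) ^ 2), ⟨⟨?_, ?_⟩, ?_, ?_⟩,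
    9 * l, ⟨le_rfl, by linarith⟩, by simp [pgamma]⟩ <;> dsimp only <;> linarith

/-- The tube is contained in a box of size `2ℓ × 20ℓ²`. -/
theorem tube_subset_prod_Ico (a c l : ℝ) (hl : 0 < l) :
    tube (Ico a (a + l) ×ˢ Ico c (c + l ^ 2)) l ⊆
      Ico (a - 10 * l) (a - 10 * l + 2 * l) ×ˢ
        Ico (c - 100 * l ^ 2) (c - 100 * l ^ 2 + 20 * l ^ 2) := by
  rintro _ ⟨⟨x, y⟩, ⟨⟨hx₁, hx₂⟩, hy₁, hy₂⟩, t, ⟨ht₁, ht₂⟩, rfl⟩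
  dsimp only at hx₁ hx₂ hy₁ hy₂
  have h₁ : (9 * l) ^ 2 ≤ t ^ 2 := pow_le_pow_left₀ (by positivity) ht₁ 2
  have h₂ : t ^ 2 ≤ (10 * l) ^ 2 := pow_le_pow_left₀ (by linarith) ht₂ 2
  refine ⟨⟨?_, ?_⟩, ?_, ?_⟩ <;> simp only [pgamma, Prod.mk_sub_mk] <;> linarith

/-- The area of a half-open rectangle given by a corner and its side lengths. -/
theorem volume_prod_Ico_add (a c : ℝ) {w : ℝ} (hw : 0 ≤ w) (h : ℝ) :
    volume (Ico a (a + w) ×ˢ Ico c (c + h) : Set (ℝ × ℝ)) = ENNReal.ofReal (w * h) := by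
  rw [Measure.volume_eq_prod, Measure.prod_prod, Real.volume_Ico, Real.volume_Ico,
    add_sub_cancel_left, add_sub_cancel_left, ENNReal.ofReal_mul hw]

/-- For a parabolic cube `Q`, the measure of `E_Q` is comparable to that of `Q` with
absolute constants: `|Q| ≤ |E_Q| ≤ 40 |Q|`. -/
theorem tube_measure_comparable (a c l : ℝ) (hl : 0 < l) :
    volume (Ico a (a + l) ×ˢ Ico c (c + l ^ 2) : Set (ℝ × ℝ)) ≤
        volume (tube (Ico a (a + l) ×ˢ Ico c (c + l ^ 2)) l) ∧
      volume (tube (Ico a (a + l) ×ˢ Ico c (c + l ^ 2)) l) ≤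
        40 * volume (Ico a (a + l) ×ˢ Ico c (c + l ^ 2) : Set (ℝ × ℝ)) := by
  constructor
  · refine le_trans (le_of_eq ?_) (measure_mono (prod_Ico_subset_tube a c l hl))
    rw [volume_prod_Ico_add _ _ hl.le, volume_prod_Ico_add _ _ hl.le]
  · refine (measure_mono (tube_subset_prod_Ico a c l hl)).trans (le_of_eq ?_)
    rw [volume_prod_Ico_add _ _ (by positivity), volume_prod_Ico_add _ _ hl.le,
      ← ENNReal.ofReal_ofNat 40, ← ENNReal.ofReal_mul (by norm_num)]
    congr 1
    ring
end
end

section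
/- Let Q and R be adjacent parabolic cubes of equal size (sharing a common boundary face), with R lying directly below or directly to the left of Q. Then there exists a parabolic cube Q̃ ⊆ Q such that E_{Q̃} = {x − γ(t) : x ∈ Q̃, 9ℓ(Q̃) ≤ t ≤ 10ℓ(Q̃)} is contained in R. -/
open MeasureTheory Set Filter

noncomputable section

/-- Given adjacent parabolic cubes `Q` and `R` of equal size with `R` directly below or
directly to the left of `Q`, there is a parabolic cube `Q̃ ⊆ Q` whose tube `E_{Q̃}` is
contained in `R`. -/
theorem small_cube_flows_into_neighbor (a c l : ℝ) (hl : 0 < l)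
    (R : Set (ℝ × ℝ))
    (hR : R = Ico a (a + l) ×ˢ Ico (c - l ^ 2) c ∨
          R = Ico (a - l) a ×ˢ Ico c (c + l ^ 2)) :
    ∃ a' c' l' : ℝ, 0 < l' ∧
      (Ico a' (a' + l') ×ˢ Ico c' (c' + l' ^ 2) : Set (ℝ × ℝ)) ⊆
        Ico a (a + l) ×ˢ Ico c (c + l ^ 2) ∧
      tube (Ico a' (a' + l') ×ˢ Ico c' (c' + l' ^ 2)) l' ⊆ R := by
  have hsq : (l / 20) ^ 2 = l ^ 2 / 400 := by ring
  have hl2 : 0 < l ^ 2 := by positivity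
  have flow_time_sq : ∀ t ∈ Icc (9 * (l / 20)) (10 * (l / 20)),
      81 * (l ^ 2 / 400) ≤ t ^ 2 ∧ t ^ 2 ≤ 100 * (l ^ 2 / 400) := by
    rintro t ⟨ht₁, ht₂⟩
    constructor <;> nlinarith
  rcases hR with rfl | rfl
  · refine ⟨a + l / 2, c, l / 20, by positivity,
      prod_mono (Ico_subset_Ico (by linarith) (by linarith))
        (Ico_subset_Ico le_rfl (by linarith)), ?_⟩
    rintro _ ⟨⟨x, y⟩, ⟨⟨hx₁, hx₂⟩, hy₁, hy₂⟩, t, ht, rfl⟩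
    obtain ⟨hs₁, hs₂⟩ := flow_time_sq t ht
    obtain ⟨ht₁, ht₂⟩ := ht
    simp only [pgamma, Prod.mk_sub_mk, mem_prod, mem_Ico] at *
    refine ⟨⟨?_, ?_⟩, ?_, ?_⟩ <;> linarith
  · refine ⟨a, c + l ^ 2 / 2, l / 20, by positivity,
      prod_mono (Ico_subset_Ico le_rfl (by linarith))
        (Ico_subset_Ico (by linarith) (by linarith)), ?_⟩
    rintro _ ⟨⟨x, y⟩, ⟨⟨hx₁, hx₂⟩, hy₁, hy₂⟩, t, ht, rfl⟩
    obtain ⟨hs₁, hs₂⟩ := flow_time_sq t ht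
    obtain ⟨ht₁, ht₂⟩ := ht
    simp only [pgamma, Prod.mk_sub_mk, mem_prod, mem_Ico] at *
    refine ⟨⟨?_, ?_⟩, ?_, ?_⟩ <;> linarith
end
end

section
/- There exists a locally integrable function b : ℝ² → ℝ such that ‖b‖_{BMO,∞} = ess sup_y ‖b(·, y)‖_{BMO(ℝ)} < ∞ but b ∉ BMO(ℝ²), i.e. sup over squares Q ⊆ ℝ² of (1/|Q|)∫_Q |b − b_Q| dA is infinite. -/
open MeasureTheory Set Filter
open scoped ENNReal

noncomputable section

/-- The average `g_I = |I|⁻¹ ∫_I g` over the interval `I = [u, v]`. -/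
def avg1 (g : ℝ → ℝ) (u v : ℝ) : ℝ := (v - u)⁻¹ * ∫ x in Icc u v, g x

/-- The mean oscillation `|I|⁻¹ ∫_I |g - g_I|` over `I = [u, v]`. -/
def osc1 (g : ℝ → ℝ) (u v : ℝ) : ℝ :=
  (v - u)⁻¹ * ∫ x in Icc u v, |g x - avg1 g u v|

/-- The `BMO(ℝ)` norm of `g`: the supremum of mean oscillations over all intervals
(as an extended real, so that `bmo1 g = ∞` means `g ∉ BMO(ℝ)`). -/
def bmo1 (g : ℝ → ℝ) : ℝ≥0∞ :=
  ⨆ (u : ℝ) (v : ℝ) (_ : u < v), ENNReal.ofReal (osc1 g u v)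

/-- The axis-parallel square `Q = [a, a+l] × [c, c+l]`. -/
def square (a c l : ℝ) : Set (ℝ × ℝ) := Icc a (a + l) ×ˢ Icc c (c + l)

/-- The average `b_Q = |Q|⁻¹ ∫_Q b` over the square `Q = [a, a+l] × [c, c+l]`. -/
def avg2 (b : ℝ × ℝ → ℝ) (a c l : ℝ) : ℝ :=
  (volume (square a c l)).toReal⁻¹ * ∫ p in square a c l, b p

/-- The mean oscillation `|Q|⁻¹ ∫_Q |b - b_Q| dA` over the square `Q = [a,a+l] × [c,c+l]`. -/
def osc2 (b : ℝ × ℝ → ℝ) (a c l : ℝ) : ℝ :=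
  (volume (square a c l)).toReal⁻¹ * ∫ p in square a c l, |b p - avg2 b a c l|

/-- The planar `BMO(ℝ²)` norm: supremum of mean oscillations over all axis-parallel squares
(as an extended real, so that `bmo2 b = ∞` means `b ∉ BMO(ℝ²)`). -/
def bmo2 (b : ℝ × ℝ → ℝ) : ℝ≥0∞ :=
  ⨆ (a : ℝ) (c : ℝ) (l : ℝ) (_ : 0 < l), ENNReal.ofReal (osc2 b a c l)

/-- `‖b‖_{BMO,∞} = ess sup_y ‖b(·, y)‖_{BMO(ℝ)}`. -/
def bmoInf (b : ℝ × ℝ → ℝ) : ℝ≥0∞ :=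
  essSup (fun y : ℝ => bmo1 fun x => b (x, y)) volume

theorem bmo1_const (y : ℝ) : bmo1 (fun _ => y) = 0 := by
  simp only [bmo1, ENNReal.iSup_eq_zero, ENNReal.ofReal_eq_zero]
  intro u v huv
  have hne : v - u ≠ 0 := (sub_pos.2 huv).ne'
  have havg : avg1 (fun _ => y) u v = y := by
    simp only [avg1, setIntegral_const, Real.volume_real_Icc_of_le huv.le, smul_eq_mul]
    field_simp
  simp [osc1, havg]

theorem volume_square_toReal (a c : ℝ) {l : ℝ} (hl : 0 ≤ l) :
    (volume (square a c l)).toReal = l * l := by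
  rw [square, Measure.volume_eq_prod, Measure.prod_prod]
  simp [hl]

theorem setIntegral_square_snd (a c : ℝ) {l : ℝ} (hl : 0 ≤ l) (f : ℝ → ℝ) :
    ∫ p in square a c l, f p.2 = l * ∫ y in c..(c + l), f y := by
  have h := setIntegral_prod_mul (μ := (volume : Measure ℝ)) (ν := (volume : Measure ℝ))
    (fun _ : ℝ => (1 : ℝ)) f (Icc a (a + l)) (Icc c (c + l))
  simp only [one_mul, setIntegral_const, smul_eq_mul, mul_one,
    Real.volume_real_Icc_of_le (show a ≤ a + l by linarith), add_sub_cancel_left] at h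
  rw [square, Measure.volume_eq_prod, h, integral_Icc_eq_integral_Ioc,
    intervalIntegral.integral_of_le (by linarith)]

/-- The lower bound follows from `|y - m| ≥ (y - m) (y - l / 2) / (l / 2)` on `[0, l]`. -/
theorem sq_div_six_le_integral_abs_sub (m : ℝ) {l : ℝ} (hl : 0 < l) :
    l ^ 2 / 6 ≤ ∫ y in (0 : ℝ)..l, |y - m| := by
  have hval : ∫ y in (0 : ℝ)..l, (y - m) * (2 * y / l - 1) = l ^ 2 / 6 := by
    have hderiv : ∀ y ∈ uIcc 0 l, HasDerivAt
        (fun y : ℝ => 2 / (3 * l) * y ^ 3 - (1 / 2 + m / l) * y ^ 2 + m * y)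
        ((y - m) * (2 * y / l - 1)) y := by
      intro y _
      have h := (((hasDerivAt_pow 3 y).const_mul (2 / (3 * l))).sub
        ((hasDerivAt_pow 2 y).const_mul (1 / 2 + m / l))).add ((hasDerivAt_id y).const_mul m)
      refine h.congr_deriv ?_
      field_simp
      push_cast
      ring
    rw [intervalIntegral.integral_eq_sub_of_hasDerivAt hderiv
      (Continuous.intervalIntegrable (by fun_prop) _ _)]
    field_simp
    ring
  rw [← hval]
  refine intervalIntegral.integral_mono_on hl.le
    (Continuous.intervalIntegrable (by fun_prop) _ _)
    (Continuous.intervalIntegrable (by fun_prop) _ _) fun y hy => ?_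
  have hle : |2 * y / l - 1| ≤ 1 := by
    have h0 : 0 ≤ 2 * y / l := div_nonneg (by linarith [hy.1]) hl.le
    have h2 : 2 * y / l ≤ 2 := (div_le_iff₀ hl).2 (by linarith [hy.2])
    exact abs_le.2 ⟨by linarith, by linarith⟩
  calc (y - m) * (2 * y / l - 1) ≤ |y - m| * |2 * y / l - 1| := by
        rw [← abs_mul]; exact le_abs_self _
    _ ≤ |y - m| := mul_le_of_le_one_right (abs_nonneg _) hle

theorem div_six_le_osc2_snd {l : ℝ} (hl : 0 < l) : l / 6 ≤ osc2 Prod.snd 0 0 l := by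
  rw [osc2, volume_square_toReal 0 0 hl.le,
    setIntegral_square_snd 0 0 hl.le (fun y => |y - avg2 Prod.snd 0 0 l|), zero_add]
  have h := sq_div_six_le_integral_abs_sub (avg2 Prod.snd 0 0 l) hl
  calc l / 6 = (l * l)⁻¹ * (l * (l ^ 2 / 6)) := by field_simp
    _ ≤ _ := by gcongr

/-- There is a locally integrable `b : ℝ² → ℝ` with
`‖b‖_{BMO,∞} = ess sup_y ‖b(·,y)‖_{BMO(ℝ)} < ∞` but `b ∉ BMO(ℝ²)`. -/
theorem exists_bmoInf_finite_not_planar_bmo :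
    ∃ b : ℝ × ℝ → ℝ, LocallyIntegrable b volume ∧ bmoInf b < ⊤ ∧ bmo2 b = ⊤ := by
  refine ⟨Prod.snd, continuous_snd.locallyIntegrable, ?_, ?_⟩
  · simp [bmoInf, bmo1_const]
  · refine ENNReal.eq_top_of_forall_nnreal_le fun r => ?_
    have hl : (0 : ℝ) < 6 * (r + 1) := by positivity
    have h : (r : ℝ) ≤ osc2 Prod.snd 0 0 (6 * (r + 1)) := by
      linarith [div_six_le_osc2_snd hl]
    calc (r : ℝ≥0∞) = ENNReal.ofReal r := (ENNReal.ofReal_coe_nnreal).symm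
      _ ≤ ENNReal.ofReal (osc2 Prod.snd 0 0 (6 * (r + 1))) := ENNReal.ofReal_le_ofReal h
      _ ≤ bmo2 Prod.snd := le_iSup_of_le 0 <| le_iSup_of_le 0 <|
          le_iSup_of_le (6 * ((r : ℝ) + 1)) <| le_iSup_of_le hl le_rfl
end
end
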